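/- Let d ≥ 3. There exists ε > 0 depending only on d such that the following holds. Let P u = Σ_{j,k} a_{jk}(x) D_j D_k u + Σ_k b_k(x) D_k u with smooth coefficients all of whose derivatives are bounded, assume P is symmetric, and assume Σ_{j,k} ‖a_{jk} − δ_{jk}‖_{0,1,1} + Σ_k ‖b_k‖_{1,0,1} < ε. Then for every Schwartz function u: Re ⟨i(PA − AP)u, u⟩ ≥ (1/2) Re ⟨Pu, u⟩, where A = (x·∇)/i + d/2 and the commutator i[P,A] = i(PA − AP) is computed as a differential operator on Schwartz functions. -/

import Mathlib

open MeasureTheory Complex Finset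
open scoped ENNReal

noncomputable section

abbrev Euc (d : ℕ) := EuclideanSpace ℝ (Fin d)

/-- Partial derivative `∂_j` of a complex-valued function on `ℝ^d`. -/
def pd {d : ℕ} (j : Fin d) (u : Euc d → ℂ) : Euc d → ℂ :=
  fun x => fderiv ℝ u x (EuclideanSpace.single j 1)

/-- Iterated partial derivative `∂^α` for a multi-index `α`. -/
def pdAlpha {d : ℕ} (α : Fin d → ℕ) (u : Euc d → ℂ) : Euc d → ℂ :=
  (List.finRange d).foldr (fun j v => (pd j)^[α j] v) u

/-- The Laplacian `Δ = Σ_j ∂_j²`. -/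
def lap {d : ℕ} (u : Euc d → ℂ) : Euc d → ℂ :=
  fun x => ∑ j, pd j (pd j u) x

/-- The operator `x·∇`. -/
def xGrad {d : ℕ} (u : Euc d → ℂ) : Euc d → ℂ :=
  fun x => ∑ j, (x j : ℂ) * pd j u x

/-- Multi-indices `α` on `Fin d` with `|α| ≤ r`. -/
def multiIndices (d r : ℕ) : Finset (Fin d → ℕ) :=
  (Fintype.piFinset fun _ : Fin d => Finset.range (r + 1)).filter
    (fun α => ∑ i, α i ≤ r)

/-- The norm `‖a‖_{o,r,N} = Σ_{n ≤ N, |α| ≤ r} ‖∂^α (x·∇)^n a‖_{L^{d/(o+|α|)}}`,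
with the convention `L^{d/0} = L^∞` (in `ℝ≥0∞`, `d/0 = ∞`). -/
def coefNorm (d o r N : ℕ) (a : Euc d → ℂ) : ℝ≥0∞ :=
  ∑ n ∈ Finset.range (N + 1), ∑ α ∈ multiIndices d r,
    eLpNorm (pdAlpha α ((xGrad (d := d))^[n] a))
      ((d : ℝ≥0∞) / ((o + ∑ i, α i : ℕ) : ℝ≥0∞)) volume

/-- The Sobolev norm `‖v‖_{H^m} = Σ_{|α| ≤ m} ‖∂^α v‖_{L²}`. -/
def sobNorm (d s : ℕ) (u : Euc d → ℂ) : ℝ≥0∞ :=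
  ∑ α ∈ multiIndices d s, eLpNorm (pdAlpha α u) 2 volume

/-- `D_j = -i ∂_j`. -/
def Dop {d : ℕ} (j : Fin d) (u : Euc d → ℂ) : Euc d → ℂ :=
  fun x => -Complex.I * pd j u x

/-- The operator `P u = Σ_{j,k} a_{jk} D_j D_k u + Σ_k b_k D_k u`. -/
def Pop {d : ℕ} (a : Fin d → Fin d → Euc d → ℂ) (b : Fin d → Euc d → ℂ)
    (u : Euc d → ℂ) : Euc d → ℂ :=
  fun x => (∑ j, ∑ k, a j k x * Dop j (Dop k u) x) + ∑ k, b k x * Dop k u x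

/-- The generator of dilations `A = (x·∇)/i + d/2`. -/
def Aop {d : ℕ} (u : Euc d → ℂ) : Euc d → ℂ :=
  fun x => -Complex.I * xGrad u x + ((d : ℂ) / 2) * u x

/-- Iterated commutators `ad_A^0 T = T`, `ad_A^{n+1} T = (ad_A^n T) A - A (ad_A^n T)`. -/
def adA {d : ℕ} : ℕ → ((Euc d → ℂ) → (Euc d → ℂ)) → ((Euc d → ℂ) → (Euc d → ℂ))
  | 0, T => T
  | n + 1, T => fun u x => adA n T (Aop u) x - Aop (adA n T u) x

/-- `P` is symmetric on Schwartz functions. -/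
def IsSymmP {d : ℕ} (a : Fin d → Fin d → Euc d → ℂ) (b : Fin d → Euc d → ℂ) : Prop :=
  ∀ u v : SchwartzMap (Euc d) ℂ,
    ∫ x, Pop a b u x * (starRingEnd ℂ) (v x) = ∫ x, u x * (starRingEnd ℂ) (Pop a b v x)

/-- Smooth with all derivatives bounded. -/
def CinftyBdd {d : ℕ} (f : Euc d → ℂ) : Prop :=
  ContDiff ℝ (⊤ : ℕ∞) f ∧ ∀ n : ℕ, ∃ C : ℝ, ∀ x, ‖iteratedFDeriv ℝ n f x‖ ≤ C

/-- `r̄(d)`: the largest integer strictly smaller than `d/2`. -/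
def rbar (d : ℕ) : ℕ := (d - 1) / 2

/-- `‖∇u‖_{L²} = (Σ_j ‖∂_j u‖_{L²}²)^{1/2}`. -/
def gradNorm {d : ℕ} (u : Euc d → ℂ) : ℝ≥0∞ :=
  (∑ j, eLpNorm (pd j u) 2 volume ^ 2) ^ (1 / 2 : ℝ)

/-- `‖∇u‖_{L²}²` as a real number, for Schwartz `u`. -/
def gradSq {d : ℕ} (u : Euc d → ℂ) : ℝ :=
  ∑ j, ∫ x, ‖pd j u x‖ ^ 2

/-- Japanese bracket `⟨x⟩ = (1+|x|²)^{1/2}`. -/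
def jap {d : ℕ} (x : Euc d) : ℝ := Real.sqrt (1 + ‖x‖ ^ 2)


open scoped ContDiff

section Calculus

variable {d : ℕ} {f g u : Euc d → ℂ}

lemma pd_add (j : Fin d) (hf : Differentiable ℝ f) (hg : Differentiable ℝ g) :
    pd j (fun x => f x + g x) = fun x => pd j f x + pd j g x := by
  ext x
  simp [pd, fderiv_fun_add (hf x) (hg x)]

lemma pd_sum {ι : Type*} (s : Finset ι) {F : ι → Euc d → ℂ} (j : Fin d)
    (hF : ∀ i ∈ s, Differentiable ℝ (F i)) :
    pd j (fun x => ∑ i ∈ s, F i x) = fun x => ∑ i ∈ s, pd j (F i) x := by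
  ext x
  simp [pd, fderiv_fun_sum fun i hi => hF i hi x]

lemma pd_const_mul (j : Fin d) (c : ℂ) (hf : Differentiable ℝ f) :
    pd j (fun x => c * f x) = fun x => c * pd j f x := by
  ext x
  simp [pd, fderiv_const_mul (hf x)]

lemma pd_mul (j : Fin d) (hf : Differentiable ℝ f) (hg : Differentiable ℝ g) :
    pd j (fun x => f x * g x) = fun x => pd j f x * g x + f x * pd j g x := by
  ext x
  simp [pd, fderiv_fun_mul (hf x) (hg x)]
  ring

lemma contDiff_pd (j : Fin d) (hf : ContDiff ℝ ∞ f) : ContDiff ℝ ∞ (pd j f) :=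
  (hf.fderiv_right (m := ∞) (by simp)).clm_apply contDiff_const

lemma contDiff_coord (j : Fin d) : ContDiff ℝ ∞ (fun x : Euc d => ((x j : ℝ) : ℂ)) :=
  Complex.ofRealCLM.contDiff.comp (EuclideanSpace.proj (𝕜 := ℝ) j).contDiff

lemma contDiff_xGrad (hf : ContDiff ℝ ∞ f) : ContDiff ℝ ∞ (xGrad f) :=
  ContDiff.sum fun j _ => (contDiff_coord j).mul (contDiff_pd j hf)

lemma smooth_differentiable (hf : ContDiff ℝ ∞ f) : Differentiable ℝ f :=
  hf.differentiable (by simp)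

lemma pd_coord (i j : Fin d) :
    pd j (fun x : Euc d => ((x i : ℝ) : ℂ)) = fun _ => if i = j then 1 else 0 := by
  ext x
  have h : HasFDerivAt (fun x : Euc d => ((x i : ℝ) : ℂ))
      (Complex.ofRealCLM.comp (EuclideanSpace.proj (𝕜 := ℝ) i)) x :=
    (Complex.ofRealCLM.comp (EuclideanSpace.proj (𝕜 := ℝ) i)).hasFDerivAt
  simp only [pd, h.fderiv]
  split_ifs with hij <;> simp [hij]

lemma pd_comm (j k : Fin d) (hu : ContDiff ℝ ∞ u) : pd j (pd k u) = pd k (pd j u) := by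
  ext x
  have hd : DifferentiableAt ℝ (fderiv ℝ u) x :=
    (hu.fderiv_right (m := ∞) (by simp)).differentiable (by simp) x
  have hs : IsSymmSndFDerivAt ℝ u x :=
    (hu.contDiffAt (x := x)).isSymmSndFDerivAt
      (by simpa using (mod_cast le_top : ((2 : ℕ∞) : WithTop ℕ∞) ≤ (⊤ : ℕ∞)))
  have key (m l : Fin d) : pd m (pd l u) x =
      fderiv ℝ (fderiv ℝ u) x (EuclideanSpace.single m 1) (EuclideanSpace.single l 1) := by
    unfold pd
    rw [fderiv_clm_apply hd (by fun_prop)]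
    simp
  rw [key, key, hs.eq]

lemma xGrad_add (hf : Differentiable ℝ f) (hg : Differentiable ℝ g) :
    xGrad (fun x => f x + g x) = fun x => xGrad f x + xGrad g x := by
  ext x
  simp [xGrad, pd_add _ hf hg, mul_add, Finset.sum_add_distrib]

lemma xGrad_sum {ι : Type*} (s : Finset ι) {F : ι → Euc d → ℂ}
    (hF : ∀ i ∈ s, Differentiable ℝ (F i)) :
    xGrad (fun x => ∑ i ∈ s, F i x) = fun x => ∑ i ∈ s, xGrad (F i) x := by
  ext x
  simp only [xGrad, pd_sum s _ hF, Finset.mul_sum]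
  exact Finset.sum_comm

lemma xGrad_const_mul (c : ℂ) (hf : Differentiable ℝ f) :
    xGrad (fun x => c * f x) = fun x => c * xGrad f x := by
  ext x
  simp only [xGrad, pd_const_mul _ c hf, Finset.mul_sum]
  exact Finset.sum_congr rfl fun j _ => by ring

lemma xGrad_mul (hf : Differentiable ℝ f) (hg : Differentiable ℝ g) :
    xGrad (fun x => f x * g x) = fun x => xGrad f x * g x + f x * xGrad g x := by
  ext x
  simp only [xGrad, pd_mul _ hf hg, Finset.mul_sum, Finset.sum_mul, ← Finset.sum_add_distrib]
  exact Finset.sum_congr rfl fun j _ => by ring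

lemma pd_xGrad (j : Fin d) (hu : ContDiff ℝ ∞ u) :
    pd j (xGrad u) = fun x => pd j u x + xGrad (pd j u) x := by
  unfold xGrad
  rw [pd_sum _ _ fun i _ => smooth_differentiable ((contDiff_coord i).mul (contDiff_pd i hu))]
  ext x
  rw [Finset.sum_congr rfl fun i _ => congrFun (pd_mul j
    (smooth_differentiable (contDiff_coord i)) (smooth_differentiable (contDiff_pd i hu))) x]
  rw [Finset.sum_add_distrib]
  congr 1
  · simp [pd_coord]
  · exact Finset.sum_congr rfl fun i _ => by rw [pd_comm j i hu]

lemma pd_pd_xGrad (j k : Fin d) (hu : ContDiff ℝ ∞ u) :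
    pd j (pd k (xGrad u)) = fun x => 2 * pd j (pd k u) x + xGrad (pd j (pd k u)) x := by
  rw [pd_xGrad k hu, pd_add j (smooth_differentiable (contDiff_pd k hu))
    (smooth_differentiable (contDiff_xGrad (contDiff_pd k hu))), pd_xGrad j (contDiff_pd k hu)]
  ext x
  ring

lemma Pop_eq (a : Fin d → Fin d → Euc d → ℂ) (b : Fin d → Euc d → ℂ) (hu : ContDiff ℝ ∞ u) :
    Pop a b u = fun x => (∑ j, ∑ k, -(a j k x * pd j (pd k u) x)) +
      ∑ k, -Complex.I * (b k x * pd k u x) := by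
  ext x
  unfold Pop Dop
  congr 1
  · refine Finset.sum_congr rfl fun j _ => Finset.sum_congr rfl fun k _ => ?_
    rw [pd_const_mul j _ (smooth_differentiable (contDiff_pd k hu))]
    linear_combination (a j k x * pd j (pd k u) x) * Complex.I_mul_I
  · exact Finset.sum_congr rfl fun k _ => by ring

lemma Pop_Aop {a : Fin d → Fin d → Euc d → ℂ} {b : Fin d → Euc d → ℂ} (hu : ContDiff ℝ ∞ u)
    (x : Euc d) :
    Pop a b (Aop u) x = -Complex.I * Pop a b (xGrad u) x + (d : ℂ) / 2 * Pop a b u x := by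
  have hx := contDiff_xGrad hu
  have hA : ContDiff ℝ ∞ (Aop u) := (contDiff_const.mul hx).add (contDiff_const.mul hu)
  have h1 {v w : Euc d → ℂ} (hv : ContDiff ℝ ∞ v) (hw : ContDiff ℝ ∞ w) (c e : ℂ) (k : Fin d) :
      pd k (fun x => c * v x + e * w x) = fun x => c * pd k v x + e * pd k w x := by
    rw [pd_add k ((smooth_differentiable hv).const_mul c) ((smooth_differentiable hw).const_mul e),
      pd_const_mul k c (smooth_differentiable hv), pd_const_mul k e (smooth_differentiable hw)]
  have h2 (k : Fin d) : pd k (Aop u) =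
      fun x => -Complex.I * pd k (xGrad u) x + (d : ℂ) / 2 * pd k u x := h1 hx hu _ _ k
  rw [Pop_eq a b hA, Pop_eq a b hx, Pop_eq a b hu]
  simp only [h2, h1 (contDiff_pd _ hx) (contDiff_pd _ hu)]
  rw [mul_add, mul_add, add_add_add_comm]
  simp only [Finset.mul_sum, ← Finset.sum_add_distrib]
  refine Finset.sum_congr rfl fun j _ => congrArg₂ (· + ·) ?_ (by ring)
  exact Finset.sum_congr rfl fun k _ => by ring

/-- The commutator `i[P, A]` is again of the form `Pop`. -/
lemma commutator_eq {a : Fin d → Fin d → Euc d → ℂ} {b : Fin d → Euc d → ℂ}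
    (ha : ∀ j k, ContDiff ℝ ∞ (a j k)) (hb : ∀ k, ContDiff ℝ ∞ (b k)) (hu : ContDiff ℝ ∞ u)
    (x : Euc d) :
    Complex.I * (Pop a b (Aop u) x - Aop (Pop a b u) x) =
      Pop (fun j k x => 2 * a j k x - xGrad (a j k) x) (fun k x => b k x - xGrad (b k) x) u x := by
  have hp2 (j k : Fin d) := contDiff_pd j (contDiff_pd k hu)
  have h1 : Complex.I * (Pop a b (Aop u) x - Aop (Pop a b u) x) =
      Pop a b (xGrad u) x - xGrad (Pop a b u) x := by
    rw [Pop_Aop hu]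
    unfold Aop
    linear_combination (xGrad (Pop a b u) x - Pop a b (xGrad u) x) * Complex.I_mul_I
  have h2 : xGrad (Pop a b u) x =
      (∑ j, ∑ k, -(xGrad (a j k) x * pd j (pd k u) x + a j k x * xGrad (pd j (pd k u)) x)) +
      ∑ k, -Complex.I * (xGrad (b k) x * pd k u x + b k x * xGrad (pd k u) x) := by
    have e1 (j k : Fin d) : xGrad (fun x => -(a j k x * pd j (pd k u) x)) x =
        -(xGrad (a j k) x * pd j (pd k u) x + a j k x * xGrad (pd j (pd k u)) x) := by
      have := congrFun (xGrad_const_mul (-1)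
        (smooth_differentiable ((ha j k).mul (hp2 j k)))) x
      simp only [neg_one_mul] at this
      rw [this, xGrad_mul (smooth_differentiable (ha j k)) (smooth_differentiable (hp2 j k))]
    have e2 (k : Fin d) : xGrad (fun x => -Complex.I * (b k x * pd k u x)) x =
        -Complex.I * (xGrad (b k) x * pd k u x + b k x * xGrad (pd k u) x) := by
      rw [xGrad_const_mul _ (smooth_differentiable ((hb k).mul (contDiff_pd k hu))),
        xGrad_mul (smooth_differentiable (hb k)) (smooth_differentiable (contDiff_pd k hu))]
    have c1 (j k : Fin d) : ContDiff ℝ ∞ (fun x => -(a j k x * pd j (pd k u) x)) :=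
      ((ha j k).mul (hp2 j k)).neg
    have c2 (k : Fin d) : ContDiff ℝ ∞ (fun x => -Complex.I * (b k x * pd k u x)) :=
      contDiff_const.mul ((hb k).mul (contDiff_pd k hu))
    rw [Pop_eq a b hu, xGrad_add
      (smooth_differentiable (ContDiff.sum fun j _ => ContDiff.sum fun k _ => c1 j k))
      (smooth_differentiable (ContDiff.sum fun k _ => c2 k)),
      xGrad_sum _ fun j _ => smooth_differentiable (ContDiff.sum fun k _ => c1 j k),
      xGrad_sum _ fun k _ => smooth_differentiable (c2 k)]
    simp only [xGrad_sum _ fun k _ => smooth_differentiable (c1 _ k), e1, e2]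
  rw [h1, h2, Pop_eq a b (contDiff_xGrad hu), Pop_eq _ _ hu]
  simp only [pd_pd_xGrad _ _ hu]
  simp only [pd_xGrad _ hu, add_sub_add_comm, ← Finset.sum_sub_distrib]
  congr 1
  · exact Finset.sum_congr rfl fun j _ => Finset.sum_congr rfl fun k _ => by ring
  · exact Finset.sum_congr rfl fun k _ => by ring

end Calculus

section Sobolev

open Filter Topology NNReal

/-- The smooth cutoffs `χ(x / (n + 1))`. -/
lemma exists_cutoff (d : ℕ) : ∃ (χ : ℕ → Euc d → ℝ) (M : ℝ≥0),
    (∀ n, ContDiff ℝ ∞ (χ n)) ∧ (∀ n, HasCompactSupport (χ n)) ∧ (∀ n x, ‖χ n x‖ ≤ 1) ∧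
    (∀ n x, ‖fderiv ℝ (χ n) x‖ ≤ M * ((n : ℝ) + 1)⁻¹) ∧
    ∀ x, Tendsto (fun n => χ n x) atTop (𝓝 1) := by
  let φ : ContDiffBump (0 : Euc d) := ⟨1, 2, by norm_num, by norm_num⟩
  have hφ : ContDiff ℝ ∞ φ := φ.contDiff
  obtain ⟨C, hC⟩ := (φ.hasCompactSupport.fderiv (𝕜 := ℝ)).exists_bound_of_continuous
    (hφ.continuous_fderiv (by simp))
  have hpos (n : ℕ) : (0 : ℝ) < ((n : ℝ) + 1)⁻¹ := by positivity
  refine ⟨fun n x => φ (((n : ℝ) + 1)⁻¹ • x), C.toNNReal, fun n => hφ.comp (by fun_prop),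
    fun n => φ.hasCompactSupport.comp_smul (hpos n).ne', fun n x => ?_, fun n x => ?_, fun x => ?_⟩
  · rw [Real.norm_of_nonneg φ.nonneg]
    exact φ.le_one
  · have h := (((hφ.differentiable (by simp)) (((n : ℝ) + 1)⁻¹ • x)).hasFDerivAt).comp x
      (((hasFDerivAt_id (𝕜 := ℝ) x)).const_smul (((n : ℝ) + 1)⁻¹))
    refine (congrArg norm (HasFDerivAt.fderiv h)).trans_le ?_
    simp only [ContinuousLinearMap.comp_smul, ContinuousLinearMap.comp_id, norm_smul,
      Real.norm_of_nonneg (hpos n).le]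
    rw [mul_comm]
    gcongr
    exact (hC _).trans (Real.le_coe_toNNReal C)
  · have h0 : Tendsto (fun n : ℕ => ((n : ℝ) + 1)⁻¹ • x) atTop (𝓝 0) := by
      have := (tendsto_one_div_add_atTop_nhds_zero_nat (𝕜 := ℝ)).smul_const x
      simpa using this
    have h1 := (hφ.continuous.tendsto 0).comp h0
    rwa [φ.one_of_mem_closedBall (by simp [φ])] at h1

lemma liminf_le_of_le_of_tendsto {v w : ℕ → ℝ≥0∞} {L : ℝ≥0∞} (h : ∀ n, v n ≤ w n)
    (hw : Tendsto w atTop (𝓝 L)) : atTop.liminf v ≤ L :=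
  hw.liminf_eq ▸ liminf_le_liminf (Eventually.of_forall h)

lemma tendsto_mul_add_inv_mul (S M : ℝ≥0) (A B : ℝ≥0∞) (hB : B ≠ ⊤) :
    Tendsto (fun n : ℕ => S * (A + ENNReal.ofReal (M * ((n : ℝ) + 1)⁻¹) * B)) atTop
      (𝓝 (S * A)) := by
  have h0 : Tendsto (fun n : ℕ => ENNReal.ofReal (M * ((n : ℝ) + 1)⁻¹)) atTop (𝓝 0) := by
    have := (tendsto_one_div_add_atTop_nhds_zero_nat (𝕜 := ℝ)).const_mul (M : ℝ)
    simpa using ENNReal.tendsto_ofReal this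
  have h1 : Tendsto (fun n : ℕ => ENNReal.ofReal (M * ((n : ℝ) + 1)⁻¹) * B) atTop (𝓝 0) := by
    rw [← zero_mul B]
    exact ENNReal.Tendsto.mul_const h0 (Or.inr hB)
  have h2 := (tendsto_const_nhds (x := A)).add h1
  rw [add_zero] at h2
  exact ENNReal.Tendsto.const_mul h2 (Or.inr ENNReal.coe_ne_top)

lemma exists_sobolev_const_of_hasCompactSupport (d : ℕ) (hd : 3 ≤ d) :
    ∃ S : ℝ≥0, ∀ v : Euc d → ℂ, ContDiff ℝ 1 v → HasCompactSupport v →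
      eLpNorm v ((2⁻¹ - (d : ℝ≥0)⁻¹)⁻¹ : ℝ≥0) volume ≤ S * eLpNorm (fderiv ℝ v) 2 volume := by
  refine ⟨SNormLESNormFDerivOfEqConst ℂ (volume : Measure (Euc d)) (2 : ℝ≥0), fun v h1 h2 => ?_⟩
  refine eLpNorm_le_eLpNorm_fderiv_of_eq (F := ℂ) volume h1 h2 (p := 2) (by norm_num)
    (by simp; omega) ?_
  have : (d : ℝ≥0)⁻¹ ≤ 2⁻¹ := by
    gcongr
    exact_mod_cast (by omega : 2 ≤ d)
  simp [NNReal.coe_sub this]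

/-- The gradient of a product with a cutoff. -/
lemma eLpNorm_fderiv_smul_le {d : ℕ} {χ : Euc d → ℝ} {u : Euc d → ℂ} (hχ : ContDiff ℝ ∞ χ)
    (hu : ContDiff ℝ ∞ u) {c : ℝ} (hc : 0 ≤ c) (hle : ∀ x, ‖χ x‖ ≤ 1)
    (hder : ∀ x, ‖fderiv ℝ χ x‖ ≤ c) :
    eLpNorm (fderiv ℝ fun x => χ x • u x) 2 volume ≤
      eLpNorm (fderiv ℝ u) 2 volume + ENNReal.ofReal c * eLpNorm u 2 volume := by
  have hdu : Continuous (fderiv ℝ u) := hu.continuous_fderiv (by simp)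
  have h1 : eLpNorm (fderiv ℝ fun x => χ x • u x) 2 volume ≤
      eLpNorm (fun x => ‖fderiv ℝ u x‖ + c * ‖u x‖) 2 volume := by
    refine eLpNorm_mono_real fun x => ?_
    rw [fderiv_fun_smul (hχ.differentiable (by simp) x) (hu.differentiable (by simp) x)]
    refine (norm_add_le _ _).trans (add_le_add ?_ ?_)
    · rw [norm_smul]
      exact mul_le_of_le_one_left (norm_nonneg _) (hle x)
    · rw [ContinuousLinearMap.norm_smulRight_apply]
      gcongr
      exact hder x
  have h2 : eLpNorm (fun x => c * ‖u x‖) 2 volume = ENNReal.ofReal c * eLpNorm u 2 volume := by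
    have h3 := eLpNorm_const_smul c (fun x => ‖u x‖) 2 (volume : Measure (Euc d))
    rw [eLpNorm_norm, Real.enorm_eq_ofReal hc] at h3
    exact h3
  have h4 := eLpNorm_add_le (p := 2) (μ := volume) (f := fun x => ‖fderiv ℝ u x‖)
    (g := fun x => c * ‖u x‖) hdu.norm.aestronglyMeasurable
    (continuous_const.mul hu.continuous.norm).aestronglyMeasurable (by norm_num)
  rw [eLpNorm_norm, h2] at h4
  exact h1.trans h4

/-- The Gagliardo–Nirenberg–Sobolev inequality on `ℝ^d` for Schwartz functions. -/
lemma schwartz_sobolev (d : ℕ) (hd : 3 ≤ d) : ∃ S : ℝ≥0, ∀ u : SchwartzMap (Euc d) ℂ,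
    eLpNorm u ((2⁻¹ - (d : ℝ≥0)⁻¹)⁻¹ : ℝ≥0) volume ≤ S * eLpNorm (fderiv ℝ u) 2 volume := by
  obtain ⟨χ, M, hχ, hcs, hle, hder, hlim⟩ := exists_cutoff d
  obtain ⟨S, hS⟩ := exists_sobolev_const_of_hasCompactSupport d hd
  refine ⟨S, fun u => ?_⟩
  have hu : ContDiff ℝ ∞ u := u.smooth _
  have hv (n : ℕ) : ContDiff ℝ ∞ (fun x => χ n x • u x) := (hχ n).smul hu
  have hbound (n : ℕ) :
      eLpNorm (fun x => χ n x • u x) ((2⁻¹ - (d : ℝ≥0)⁻¹)⁻¹ : ℝ≥0) volume ≤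
      S * (eLpNorm (fderiv ℝ u) 2 volume +
        ENNReal.ofReal (M * ((n : ℝ) + 1)⁻¹) * eLpNorm u 2 volume) :=
    (hS _ ((hv n).of_le (by simp)) (hcs n).smul_right).trans
      (mul_le_mul_right (eLpNorm_fderiv_smul_le (hχ n) hu (by positivity) (hle n) (hder n)) _)
  have hfatou := Lp.eLpNorm_lim_le_liminf_eLpNorm (p := ((2⁻¹ - (d : ℝ≥0)⁻¹)⁻¹ : ℝ≥0))
    (fun n => (hv n).continuous.aestronglyMeasurable (μ := volume)) u
    (ae_of_all _ fun x => by simpa using (hlim x).smul_const (u x))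
  refine hfatou.trans (liminf_le_of_le_of_tendsto hbound (tendsto_mul_add_inv_mul S M _ _ ?_))
  exact (u.eLpNorm_lt_top 2 volume).ne

end Sobolev

section IntegrationByParts

variable {d : ℕ}

lemma hasTemperateGrowth_fderiv {f : Euc d → ℂ} (hf : f.HasTemperateGrowth) :
    (fderiv ℝ f).HasTemperateGrowth := by
  refine ⟨hf.1.fderiv_right (by simp), fun n => ?_⟩
  obtain ⟨k, C, h⟩ := hf.2 (n + 1)
  exact ⟨k, C, fun x => by simpa only [norm_iteratedFDeriv_fderiv] using h x⟩

lemma hasTemperateGrowth_pd (j : Fin d) {f : Euc d → ℂ} (hf : f.HasTemperateGrowth) :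
    (pd j f).HasTemperateGrowth :=
  (ContinuousLinearMap.hasTemperateGrowth (ContinuousLinearMap.apply ℝ ℂ
    (EuclideanSpace.single j (1 : ℝ) : Euc d))).comp (hasTemperateGrowth_fderiv hf)

lemma hasTemperateGrowth_xGrad {f : Euc d → ℂ} (hf : f.HasTemperateGrowth) :
    (xGrad f).HasTemperateGrowth :=
  Function.HasTemperateGrowth.sum fun j _ => (ContinuousLinearMap.hasTemperateGrowth
    (Complex.ofRealCLM.comp (EuclideanSpace.proj (𝕜 := ℝ) j))).mul (hasTemperateGrowth_pd j hf)

lemma CinftyBdd.hasTemperateGrowth {f : Euc d → ℂ} (hf : CinftyBdd f) : f.HasTemperateGrowth :=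
  ⟨hf.1, fun n => ⟨0, (hf.2 n).choose, fun x => by simpa using (hf.2 n).choose_spec x⟩⟩

/-- Partial derivative on Schwartz space. -/
def pdS (j : Fin d) (u : SchwartzMap (Euc d) ℂ) : SchwartzMap (Euc d) ℂ :=
  LineDeriv.lineDerivOp (EuclideanSpace.single j (1 : ℝ) : Euc d) u

lemma coe_pdS (j : Fin d) (u : SchwartzMap (Euc d) ℂ) : ⇑(pdS j u) = pd j u := rfl

lemma integrable_mul_conj {c : Euc d → ℂ} (hc : c.HasTemperateGrowth)
    (f g : SchwartzMap (Euc d) ℂ) :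
    Integrable (fun x => c x * f x * (starRingEnd ℂ) (g x)) := by
  have h : Integrable (⇑(SchwartzMap.smulLeftCLM ℂ c f) * star ⇑g) :=
    (SchwartzMap.memLp _ 2 volume).integrable_mul (g.memLp 2 volume).star
  refine h.congr (ae_of_all _ fun x => ?_)
  simp [SchwartzMap.smulLeftCLM_apply_apply hc]

lemma pd_conj (j : Fin d) {g : Euc d → ℂ} (hg : Differentiable ℝ g) :
    pd j (fun x => (starRingEnd ℂ) (g x)) = fun x => (starRingEnd ℂ) (pd j g x) := by
  ext x
  have h := (Complex.conjCLE.toContinuousLinearMap.hasFDerivAt (x := g x)).comp x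
    (hg x).hasFDerivAt
  exact congrArg (fun L => L (EuclideanSpace.single j (1 : ℝ))) h.fderiv

lemma integral_mul_pd_mul_conj {c : Euc d → ℂ} (hc : c.HasTemperateGrowth) (j : Fin d)
    (f g : SchwartzMap (Euc d) ℂ) :
    ∫ x, c x * pd j f x * (starRingEnd ℂ) (g x) =
      -((∫ x, c x * f x * (starRingEnd ℂ) (pd j g x)) +
        ∫ x, pd j c x * f x * (starRingEnd ℂ) (g x)) := by
  have hcd := smooth_differentiable hc.1
  have hgd : Differentiable ℝ (fun x => (starRingEnd ℂ) (g x)) :=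
    Complex.conjCLE.differentiable.comp g.differentiable
  have i1 := integrable_mul_conj hc f (pdS j g)
  have i2 := integrable_mul_conj (hasTemperateGrowth_pd j hc) f g
  have e : ∀ x, pd j (fun x => c x * (starRingEnd ℂ) (g x)) x * f x =
      c x * f x * (starRingEnd ℂ) (pdS j g x) + pd j c x * f x * (starRingEnd ℂ) (g x) := by
    intro x
    rw [pd_mul j hcd hgd, pd_conj j g.differentiable, coe_pdS]
    ring
  have key := integral_mul_fderiv_eq_neg_fderiv_mul_of_integrable (𝕜 := ℂ) (μ := volume)
    (f := fun x => c x * (starRingEnd ℂ) (g x)) (g := f)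
    (v := (EuclideanSpace.single j (1 : ℝ) : Euc d))
    ((i1.add i2).congr (ae_of_all _ fun x => (e x).symm))
    ((integrable_mul_conj hc (pdS j f) g).congr (ae_of_all _ fun x => by
      simp only [coe_pdS, pd]; ring))
    ((integrable_mul_conj hc f g).congr (ae_of_all _ fun x => by ring))
    (fun x _ => (hcd x).mul (hgd x)) (fun x _ => f.differentiable x)
  rw [← coe_pdS j g, ← integral_add i1 i2, ← integral_congr_ae (ae_of_all _ e)]
  refine Eq.trans ?_ key
  exact integral_congr_ae (ae_of_all _ fun x => by simp only [pd]; ring)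

lemma Pop_mul_conj_eq (c : Fin d → Fin d → Euc d → ℂ) (e : Fin d → Euc d → ℂ)
    (u : SchwartzMap (Euc d) ℂ) (x : Euc d) :
    Pop c e u x * (starRingEnd ℂ) (u x) =
      (∑ j, ∑ k, -(c j k x * pdS j (pdS k u) x * (starRingEnd ℂ) (u x))) +
      ∑ k, -Complex.I * (e k x * pdS k u x * (starRingEnd ℂ) (u x)) := by
  rw [Pop_eq c e (u.smooth _)]
  simp only [add_mul, Finset.sum_mul, coe_pdS]
  congr 1
  · exact Finset.sum_congr rfl fun j _ => Finset.sum_congr rfl fun k _ => by ring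
  · exact Finset.sum_congr rfl fun k _ => by ring

lemma integrable_Pop {c : Fin d → Fin d → Euc d → ℂ} {e : Fin d → Euc d → ℂ}
    (hc : ∀ j k, (c j k).HasTemperateGrowth) (he : ∀ k, (e k).HasTemperateGrowth)
    (u : SchwartzMap (Euc d) ℂ) : Integrable fun x => Pop c e u x * (starRingEnd ℂ) (u x) := by
  simp only [Pop_mul_conj_eq]
  exact (integrable_finsetSum _ fun j _ => integrable_finsetSum _ fun k _ =>
    (integrable_mul_conj (hc j k) _ u).neg).add
    (integrable_finsetSum _ fun k _ => (integrable_mul_conj (he k) _ u).const_mul _)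

/-- The quadratic form of `P` after integration by parts. -/
lemma integral_Pop {c : Fin d → Fin d → Euc d → ℂ} {e : Fin d → Euc d → ℂ}
    (hc : ∀ j k, (c j k).HasTemperateGrowth) (he : ∀ k, (e k).HasTemperateGrowth)
    (u : SchwartzMap (Euc d) ℂ) :
    ∫ x, Pop c e u x * (starRingEnd ℂ) (u x) =
      (∑ j, ∑ k, ((∫ x, c j k x * pd k u x * (starRingEnd ℂ) (pd j u x)) +
        ∫ x, pd j (c j k) x * pd k u x * (starRingEnd ℂ) (u x))) +
      ∑ k, -Complex.I * ∫ x, e k x * pd k u x * (starRingEnd ℂ) (u x) := by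
  simp only [Pop_mul_conj_eq]
  have i1 (j k : Fin d) := (integrable_mul_conj (hc j k) (pdS j (pdS k u)) u).fun_neg
  have i2 (k : Fin d) := (integrable_mul_conj (he k) (pdS k u) u).const_mul (-Complex.I)
  rw [integral_add (integrable_finsetSum _ fun j _ => integrable_finsetSum _ fun k _ => i1 j k)
    (integrable_finsetSum _ fun k _ => i2 k),
    integral_finsetSum _ fun j _ => integrable_finsetSum _ fun k _ => i1 j k,
    integral_finsetSum _ fun k _ => i2 k]
  congr 1
  · refine Finset.sum_congr rfl fun j _ => ?_
    rw [integral_finsetSum _ fun k _ => i1 j k]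
    refine Finset.sum_congr rfl fun k _ => ?_
    rw [integral_neg, coe_pdS j, integral_mul_pd_mul_conj (hc j k), neg_neg]
    rfl
  · exact Finset.sum_congr rfl fun k _ => integral_const_mul _ _

end IntegrationByParts

section Estimates

open NNReal

variable {d : ℕ}

lemma gradSq_nonneg (u : Euc d → ℂ) : 0 ≤ gradSq u :=
  Finset.sum_nonneg fun _ _ => integral_nonneg fun _ => by positivity

lemma eLpNorm_pd_le (j : Fin d) (u : SchwartzMap (Euc d) ℂ) :
    eLpNorm (pd j u) 2 volume ≤ ENNReal.ofReal (Real.sqrt (gradSq u)) := by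
  rw [← coe_pdS, ((pdS j u).memLp 2 volume).eLpNorm_eq_integral_rpow_norm (by simp) (by simp)]
  refine ENNReal.ofReal_le_ofReal ?_
  rw [Real.sqrt_eq_rpow, coe_pdS]
  simp only [ENNReal.toReal_ofNat, Real.rpow_ofNat, one_div]
  refine Real.rpow_le_rpow (integral_nonneg fun _ => by positivity) ?_ (by norm_num)
  exact Finset.single_le_sum (f := fun j => ∫ x, ‖pd j u x‖ ^ 2)
    (fun _ _ => integral_nonneg fun _ => by positivity) (Finset.mem_univ j)

lemma norm_le_sum_norm_apply_single (L : Euc d →L[ℝ] ℂ) :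
    ‖L‖ ≤ ∑ j, ‖L (EuclideanSpace.single j 1)‖ := by
  refine L.opNorm_le_bound (Finset.sum_nonneg fun _ _ => norm_nonneg _) fun x => ?_
  have hx : x = ∑ j, x j • (EuclideanSpace.single j 1 : Euc d) := by
    simpa using ((EuclideanSpace.basisFun (Fin d) ℝ).sum_repr x).symm
  conv_lhs => rw [hx]
  rw [map_sum, Finset.sum_mul]
  refine (norm_sum_le _ _).trans (Finset.sum_le_sum fun j _ => ?_)
  rw [map_smul, norm_smul, mul_comm]
  exact mul_le_mul_of_nonneg_left (PiLp.norm_apply_le x j) (norm_nonneg _)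

lemma eLpNorm_fderiv_le (u : SchwartzMap (Euc d) ℂ) :
    eLpNorm (fderiv ℝ u) 2 volume ≤ ENNReal.ofReal (d * Real.sqrt (gradSq u)) := by
  have h1 : eLpNorm (fderiv ℝ u) 2 volume ≤ eLpNorm (fun x => ∑ j, ‖pd j u x‖) 2 volume :=
    eLpNorm_mono_real fun x => norm_le_sum_norm_apply_single _
  have h2 : eLpNorm (∑ j, fun x => ‖pd j u x‖) 2 volume ≤
      ∑ j, eLpNorm (fun x => ‖pd j u x‖) 2 volume :=
    eLpNorm_sum_le (fun j _ => (pdS j u).continuous.norm.aestronglyMeasurable) (by norm_num)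
  have h3 : (∑ j, fun x => ‖pd j u x‖) = fun x => ∑ j, ‖pd j u x‖ := by
    ext x
    simp
  rw [h3] at h2
  refine h1.trans (h2.trans ?_)
  refine (Finset.sum_le_sum fun j _ => (eLpNorm_norm (pd j u)).trans_le
    (eLpNorm_pd_le j u)).trans ?_
  rw [Finset.sum_const, ENNReal.ofReal_mul (by positivity)]
  simp

/-- The Sobolev inequality in terms of the Dirichlet form. -/
lemma exists_sobolev_gradSq (d : ℕ) (hd : 3 ≤ d) : ∃ S : ℝ, 0 ≤ S ∧
    ∀ u : SchwartzMap (Euc d) ℂ, eLpNorm u ((2⁻¹ - (d : ℝ≥0)⁻¹)⁻¹ : ℝ≥0) volume ≤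
      ENNReal.ofReal (S * Real.sqrt (gradSq u)) := by
  obtain ⟨S, hS⟩ := schwartz_sobolev d hd
  refine ⟨S * d, by positivity, fun u => (hS u).trans ?_⟩
  rw [mul_assoc, ENNReal.ofReal_mul (by positivity), ENNReal.ofReal_coe_nnreal]
  gcongr
  exact eLpNorm_fderiv_le u

lemma norm_integral_mul_conj_le {p q : ℝ≥0∞} [ENNReal.HolderTriple p q 2] {c f g : Euc d → ℂ}
    (hc : Continuous c) (hf : Continuous f) (hg : Continuous g) {α β γ : ℝ} (hα : 0 ≤ α)
    (hβ : 0 ≤ β) (hγ : 0 ≤ γ) (h1 : eLpNorm c p volume ≤ ENNReal.ofReal α)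
    (h2 : eLpNorm g q volume ≤ ENNReal.ofReal β) (h3 : eLpNorm f 2 volume ≤ ENNReal.ofReal γ) :
    ‖∫ x, c x * f x * (starRingEnd ℂ) (g x)‖ ≤ α * β * γ := by
  have hcg : eLpNorm (c • g) 2 volume ≤ eLpNorm c p volume * eLpNorm g q volume :=
    eLpNorm_smul_le_mul_eLpNorm hg.aestronglyMeasurable hc.aestronglyMeasurable
  have hcgf : eLpNorm ((c • g) • f) 1 volume ≤ eLpNorm (c • g) 2 volume * eLpNorm f 2 volume :=
    eLpNorm_smul_le_mul_eLpNorm hf.aestronglyMeasurable (hc.smul hg).aestronglyMeasurable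
  have hint : ‖∫ x, c x * f x * (starRingEnd ℂ) (g x)‖ₑ ≤ eLpNorm ((c • g) • f) 1 volume := by
    refine (enorm_integral_le_lintegral_enorm _).trans ?_
    rw [eLpNorm_one_eq_lintegral_enorm]
    refine lintegral_mono fun x => le_of_eq ?_
    rw [← ofReal_norm, ← ofReal_norm]
    congr 1
    simp only [norm_mul, RCLike.norm_conj, Pi.smul_apply', smul_eq_mul, Pi.mul_apply]
    ring
  have hfin : ‖∫ x, c x * f x * (starRingEnd ℂ) (g x)‖ₑ ≤ ENNReal.ofReal (α * β * γ) := by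
    rw [ENNReal.ofReal_mul (by positivity), ENNReal.ofReal_mul hα]
    exact hint.trans (hcgf.trans (mul_le_mul' (hcg.trans (mul_le_mul' h1 h2)) h3))
  rw [← ofReal_norm] at hfin
  exact (ENNReal.ofReal_le_ofReal_iff (by positivity)).1 hfin

lemma holderTriple_sobolev (hd : 3 ≤ d) :
    ENNReal.HolderTriple (d : ℝ≥0∞) ((2⁻¹ - (d : ℝ≥0)⁻¹)⁻¹ : ℝ≥0) 2 := by
  have h0 : (d : ℝ≥0) ≠ 0 := by positivity
  have hlt : (d : ℝ≥0)⁻¹ < 2⁻¹ := by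
    have : (2 : ℝ≥0) < d := by exact_mod_cast (by omega : 2 < d)
    gcongr
  have hne : (2⁻¹ - (d : ℝ≥0)⁻¹) ≠ 0 := (tsub_pos_of_lt hlt).ne'
  refine ⟨?_⟩
  have h : (d : ℝ≥0)⁻¹ + (2⁻¹ - (d : ℝ≥0)⁻¹) = 2⁻¹ := add_tsub_cancel_of_le hlt.le
  have h' := congrArg (fun t : ℝ≥0 => (t : ℝ≥0∞)) h
  simp only [ENNReal.coe_add] at h'
  rw [ENNReal.coe_inv h0, ENNReal.coe_inv two_ne_zero] at h'
  rw [ENNReal.coe_inv hne, inv_inv]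
  simpa using h'

/-- Smallness of the quadratic form of an operator with small coefficients. -/
lemma norm_integral_Pop_le (hd : 3 ≤ d) {S δ : ℝ} (hS : 0 ≤ S) (hδ : 0 ≤ δ)
    (u : SchwartzMap (Euc d) ℂ)
    (hu : eLpNorm u ((2⁻¹ - (d : ℝ≥0)⁻¹)⁻¹ : ℝ≥0) volume ≤
      ENNReal.ofReal (S * Real.sqrt (gradSq u)))
    {c : Fin d → Fin d → Euc d → ℂ} {e : Fin d → Euc d → ℂ}
    (hc : ∀ j k, (c j k).HasTemperateGrowth) (he : ∀ k, (e k).HasTemperateGrowth)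
    (hc0 : ∀ j k, eLpNorm (c j k) ⊤ volume ≤ ENNReal.ofReal δ)
    (hc1 : ∀ j k, eLpNorm (pd j (c j k)) d volume ≤ ENNReal.ofReal δ)
    (he0 : ∀ k, eLpNorm (e k) d volume ≤ ENNReal.ofReal δ) :
    ‖∫ x, Pop c e u x * (starRingEnd ℂ) (u x)‖ ≤
      ((d : ℝ) * d * (1 + S) + d * S) * δ * gradSq u := by
  set N := Real.sqrt (gradSq u)
  have hN : N * N = gradSq u := Real.mul_self_sqrt (gradSq_nonneg u)
  have hN0 : 0 ≤ N := Real.sqrt_nonneg _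
  have := holderTriple_sobolev hd
  have hpd (k : Fin d) : Continuous (pd k u) := (pdS k u).continuous
  have b1 (j k : Fin d) : ‖∫ x, c j k x * pd k u x * (starRingEnd ℂ) (pd j u x)‖ ≤ δ * N * N :=
    norm_integral_mul_conj_le (hc j k).1.continuous (hpd k) (hpd j) hδ hN0 hN0 (hc0 j k)
      (eLpNorm_pd_le j u) (eLpNorm_pd_le k u)
  have b2 (j k : Fin d) : ‖∫ x, pd j (c j k) x * pd k u x * (starRingEnd ℂ) (u x)‖ ≤
      δ * (S * N) * N :=
    norm_integral_mul_conj_le (hasTemperateGrowth_pd j (hc j k)).1.continuous (hpd k)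
      u.continuous hδ (by positivity) hN0 (hc1 j k) hu (eLpNorm_pd_le k u)
  have b3 (k : Fin d) : ‖∫ x, e k x * pd k u x * (starRingEnd ℂ) (u x)‖ ≤ δ * (S * N) * N :=
    norm_integral_mul_conj_le (he k).1.continuous (hpd k)
      u.continuous hδ (by positivity) hN0 (he0 k) hu (eLpNorm_pd_le k u)
  rw [integral_Pop hc he]
  refine (norm_add_le _ _).trans ?_
  have s1 : ‖∑ j, ∑ k, ((∫ x, c j k x * pd k u x * (starRingEnd ℂ) (pd j u x)) +
      ∫ x, pd j (c j k) x * pd k u x * (starRingEnd ℂ) (u x))‖ ≤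
      ∑ _j : Fin d, ∑ _k : Fin d, (δ * N * N + δ * (S * N) * N) :=
    norm_sum_le_of_le _ fun j _ => norm_sum_le_of_le _ fun k _ =>
      (norm_add_le _ _).trans (add_le_add (b1 j k) (b2 j k))
  have s2 : ‖∑ k, -Complex.I * ∫ x, e k x * pd k u x * (starRingEnd ℂ) (u x)‖ ≤
      ∑ _k : Fin d, δ * (S * N) * N :=
    norm_sum_le_of_le _ fun k _ => by simpa using b3 k
  refine (add_le_add s1 s2).trans (le_of_eq ?_)
  rw [← hN]
  simp only [Finset.sum_const, Finset.card_univ, Fintype.card_fin, nsmul_eq_mul]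
  ring

lemma pd_const (j : Fin d) (z : ℂ) : pd j (fun _ => z) = fun _ => 0 := by
  ext x
  simp [pd]

/-- The quadratic form of a multiple of the flat Laplacian. -/
lemma integral_Pop_flat (z : ℂ) (u : SchwartzMap (Euc d) ℂ) :
    ∫ x, Pop (fun j k _ => if j = k then z else 0) (fun _ _ => 0) u x * (starRingEnd ℂ) (u x) =
      z * gradSq u := by
  rw [integral_Pop (fun _ _ => .const _) (fun _ => .const _)]
  have h (j k : Fin d) : ∫ x, (if j = k then z else 0) * pd k u x * (starRingEnd ℂ) (pd j u x) =
      if j = k then z * ∫ x, ‖pd j u x‖ ^ 2 else 0 := by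
    split_ifs with hjk
    · subst hjk
      rw [← integral_complex_ofReal, ← integral_const_mul]
      refine integral_congr_ae (ae_of_all _ fun x => ?_)
      simp only [mul_assoc, Complex.mul_conj']
      simp
    · simp
  simp only [h, pd_const]
  simp [gradSq, Finset.mul_sum]

end Estimates

section CoefficientNorms

variable {d : ℕ}

lemma foldr_pd_zero (l : List (Fin d)) (α : Fin d → ℕ) (h : ∀ i ∈ l, α i = 0) (f : Euc d → ℂ) :
    l.foldr (fun j v => (pd j)^[α j] v) f = f := by
  induction l with
  | nil => rfl
  | cons i l ih =>
    rw [List.foldr_cons, ih fun k hk => h k (List.mem_cons_of_mem _ hk), h i List.mem_cons_self]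
    rfl

lemma pdAlpha_zero (f : Euc d → ℂ) : pdAlpha 0 f = f :=
  foldr_pd_zero _ _ (fun _ _ => rfl) f

lemma foldr_pd_single (j : Fin d) (l : List (Fin d)) (hl : l.Nodup) (hj : j ∈ l)
    (f : Euc d → ℂ) :
    l.foldr (fun i v => (pd i)^[(Pi.single j 1 : Fin d → ℕ) i] v) f = pd j f := by
  induction l with
  | nil => simp at hj
  | cons i l ih =>
    rw [List.nodup_cons] at hl
    rw [List.foldr_cons]
    by_cases hij : i = j
    · subst hij
      rw [foldr_pd_zero l _ fun k hk => Pi.single_eq_of_ne (ne_of_mem_of_not_mem hk hl.1) _]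
      simp
    · rw [ih hl.2 ((List.mem_cons.1 hj).resolve_left (Ne.symm hij)), Pi.single_eq_of_ne hij]
      rfl

lemma pdAlpha_single (j : Fin d) (f : Euc d → ℂ) : pdAlpha (Pi.single j 1) f = pd j f :=
  foldr_pd_single j _ (List.nodup_finRange d) (List.mem_finRange j) f

lemma eLpNorm_le_coefNorm {o r N n : ℕ} {α : Fin d → ℕ} (hn : n ≤ N) (hα : ∑ i, α i ≤ r)
    (f : Euc d → ℂ) :
    eLpNorm (pdAlpha α (xGrad^[n] f)) ((d : ℝ≥0∞) / ((o + ∑ i, α i : ℕ) : ℝ≥0∞)) volume ≤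
      coefNorm d o r N f := by
  have hmem : α ∈ multiIndices d r := by
    simp only [multiIndices, Finset.mem_filter, Fintype.mem_piFinset, Finset.mem_range]
    exact ⟨fun i => Nat.lt_succ_of_le ((Finset.single_le_sum (fun _ _ => Nat.zero_le _)
      (Finset.mem_univ i)).trans hα), hα⟩
  refine le_trans ?_ (Finset.single_le_sum (f := fun n => ∑ α ∈ multiIndices d r,
    eLpNorm (pdAlpha α (xGrad^[n] f)) ((d : ℝ≥0∞) / ((o + ∑ i, α i : ℕ) : ℝ≥0∞)) volume)
    (fun _ _ => zero_le) (Finset.mem_range.2 (Nat.lt_succ_of_le hn)))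
  exact Finset.single_le_sum (f := fun α => eLpNorm (pdAlpha α (xGrad^[n] f))
    ((d : ℝ≥0∞) / ((o + ∑ i, α i : ℕ) : ℝ≥0∞)) volume) (fun _ _ => zero_le) hmem

lemma eLpNorm_top_le_coefNorm (hd : 0 < d) {N n r : ℕ} (hn : n ≤ N) (f : Euc d → ℂ) :
    eLpNorm (xGrad^[n] f) ⊤ volume ≤ coefNorm d 0 r N f := by
  have h := eLpNorm_le_coefNorm (o := 0) (r := r) (α := 0) hn (by simp) f
  rwa [pdAlpha_zero, show (d : ℝ≥0∞) / ((0 + ∑ i : Fin d, (0 : Fin d → ℕ) i : ℕ) : ℝ≥0∞) = ⊤ by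
    simp [ENNReal.div_zero, hd.ne']] at h

lemma eLpNorm_pd_le_coefNorm {N n : ℕ} (hn : n ≤ N) (j : Fin d) (f : Euc d → ℂ) :
    eLpNorm (pd j (xGrad^[n] f)) d volume ≤ coefNorm d 0 1 N f := by
  have h := eLpNorm_le_coefNorm (o := 0) (r := 1) (α := Pi.single j 1) hn (by simp) f
  rwa [pdAlpha_single, show (d : ℝ≥0∞) / ((0 + ∑ i, (Pi.single j 1 : Fin d → ℕ) i : ℕ) : ℝ≥0∞) = d
    by simp] at h

lemma eLpNorm_le_coefNorm_one {N n r : ℕ} (hn : n ≤ N) (f : Euc d → ℂ) :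
    eLpNorm (xGrad^[n] f) d volume ≤ coefNorm d 1 r N f := by
  have h := eLpNorm_le_coefNorm (o := 1) (r := r) (α := 0) hn (by simp) f
  rwa [pdAlpha_zero, show (d : ℝ≥0∞) / ((1 + ∑ i : Fin d, (0 : Fin d → ℕ) i : ℕ) : ℝ≥0∞) = d by
    simp] at h

lemma eLpNorm_const_mul_sub_le {p : ℝ≥0∞} (hp : 1 ≤ p) {f g : Euc d → ℂ} (hf : Continuous f)
    (hg : Continuous g) {ε s : ℝ} (hs : 0 ≤ s) (hs' : s ≤ 3 / 2) (hε : 0 ≤ ε)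
    (h1 : eLpNorm f p volume ≤ ENNReal.ofReal ε) (h2 : eLpNorm g p volume ≤ ENNReal.ofReal ε) :
    eLpNorm (fun x => (s : ℂ) * f x - g x) p volume ≤ ENNReal.ofReal (5 / 2 * ε) := by
  have h3 : eLpNorm (fun x => (s : ℂ) * f x) p volume = ENNReal.ofReal s * eLpNorm f p volume := by
    have h := eLpNorm_const_smul (s : ℂ) f p (volume : Measure (Euc d))
    rw [← ofReal_norm, Complex.norm_of_nonneg hs] at h
    exact h
  refine (eLpNorm_sub_le (f := fun x => (s : ℂ) * f x) (g := g)
    (continuous_const.mul hf).aestronglyMeasurable hg.aestronglyMeasurable hp).trans ?_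
  rw [h3]
  calc ENNReal.ofReal s * eLpNorm f p volume + eLpNorm g p volume
      ≤ ENNReal.ofReal (3 / 2) * ENNReal.ofReal ε + ENNReal.ofReal ε := by gcongr
    _ = ENNReal.ofReal (5 / 2 * ε) := by
      rw [← ENNReal.ofReal_mul (by norm_num), ← ENNReal.ofReal_add (by positivity) hε]
      congr 1
      ring

end CoefficientNorms

lemma CinftyBdd.sub_const {d : ℕ} {f : Euc d → ℂ} (hf : CinftyBdd f) (z : ℂ) :
    (fun x => f x - z).HasTemperateGrowth :=
  hf.hasTemperateGrowth.sub (.const z)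

/-- The difference between the commutator and half the operator splits into a flat Laplacian and
a perturbation whose coefficients are controlled by those of `a - δ` and `b`. -/
lemma commutator_sub_half_eq {d : ℕ} {a : Fin d → Fin d → Euc d → ℂ} {b : Fin d → Euc d → ℂ}
    (ha : ∀ j k, CinftyBdd (a j k)) (hb : ∀ k, CinftyBdd (b k)) (u : SchwartzMap (Euc d) ℂ)
    (x : Euc d) :
    Complex.I * (Pop a b (Aop u) x - Aop (Pop a b u) x) =
      (1 / 2 : ℝ) * Pop a b u x +
      (Pop (fun j k _ => if j = k then (3 / 2 : ℂ) else 0) (fun _ _ => 0) u x +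
        Pop (fun j k x => ((3 / 2 : ℝ) : ℂ) * (a j k x - if j = k then 1 else 0) -
          xGrad (fun x => a j k x - if j = k then 1 else 0) x)
        (fun k x => ((1 / 2 : ℝ) : ℂ) * b k x - xGrad (b k) x) u x) := by
  have hx (j k : Fin d) : xGrad (fun x => a j k x - if j = k then 1 else 0) = xGrad (a j k) := by
    ext y
    simp only [xGrad, pd, fderiv_sub_const]
  rw [commutator_eq (fun j k => (ha j k).1) (fun k => (hb k).1) (u.smooth ⊤)]
  simp only [Pop, hx, Finset.mul_sum, mul_add, ← Finset.sum_add_distrib]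
  have hcomm (p q r s t v : ℂ) : p + q + (r + s + (t + v)) = p + (r + t) + (q + (s + v)) := by
    ring
  refine Finset.sum_congr rfl fun j _ => ?_
  rw [hcomm]
  simp only [← Finset.sum_add_distrib]
  congr 1
  · refine Finset.sum_congr rfl fun k _ => ?_
    split_ifs <;> push_cast <;> ring
  · push_cast
    ring

/-- There is `ε > 0` (depending only on `d`) such that for every symmetric `P`
with `C^∞_b` coefficients satisfying `Σ_{j,k} ‖a_{jk} - δ_{jk}‖_{0,1,1} + Σ_k ‖b_k‖_{1,0,1} < ε`,
one has the positive commutator estimate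
`Re ⟨i(PA - AP)u, u⟩ ≥ (1/2) Re ⟨Pu, u⟩` for all Schwartz `u`. -/
theorem statement6 (d : ℕ) (hd : 3 ≤ d) :
    ∃ ε : ℝ, 0 < ε ∧
      ∀ (a : Fin d → Fin d → Euc d → ℂ) (b : Fin d → Euc d → ℂ),
        (∀ j k, CinftyBdd (a j k)) → (∀ k, CinftyBdd (b k)) →
        IsSymmP a b →
        (∑ j : Fin d, ∑ k : Fin d,
            coefNorm d 0 1 1 (fun x => a j k x - if j = k then 1 else 0)) +
          ∑ k : Fin d, coefNorm d 1 0 1 (b k) < ENNReal.ofReal ε →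
        ∀ u : SchwartzMap (Euc d) ℂ,
          (1 / 2 : ℝ) * (∫ x, Pop a b ⇑u x * (starRingEnd ℂ) (u x)).re ≤
            (∫ x, (Complex.I * (Pop a b (Aop ⇑u) x - Aop (Pop a b ⇑u) x)) *
              (starRingEnd ℂ) (u x)).re := by
  obtain ⟨S, hS, hSob⟩ := exists_sobolev_gradSq d hd
  set K : ℝ := (d : ℝ) * d * (1 + S) + d * S with hK
  have hK0 : 0 ≤ K := by positivity
  refine ⟨1 / (2 * (K + 1)), by positivity, fun a b ha hb _ hsmall u => ?_⟩
  set ε : ℝ := 1 / (2 * (K + 1)) with hε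
  have hε0 : 0 ≤ ε := by positivity
  set e : Fin d → Fin d → Euc d → ℂ := fun j k x => a j k x - if j = k then 1 else 0 with he
  have hnorm_e (j k : Fin d) : coefNorm d 0 1 1 (e j k) ≤ ENNReal.ofReal ε :=
    (Finset.single_le_sum (f := fun k => coefNorm d 0 1 1 (e j k)) (fun _ _ => zero_le)
      (Finset.mem_univ k)).trans ((Finset.single_le_sum
        (f := fun j => ∑ k, coefNorm d 0 1 1 (e j k)) (fun _ _ => zero_le)
        (Finset.mem_univ j)).trans (le_self_add.trans hsmall.le))
  have hnorm_b (k : Fin d) : coefNorm d 1 0 1 (b k) ≤ ENNReal.ofReal ε :=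
    (Finset.single_le_sum (f := fun k => coefNorm d 1 0 1 (b k)) (fun _ _ => zero_le)
      (Finset.mem_univ k)).trans (le_add_self.trans hsmall.le)
  have hte (j k : Fin d) : (e j k).HasTemperateGrowth := (ha j k).sub_const _
  have htxe (j k : Fin d) : (xGrad (e j k)).HasTemperateGrowth := hasTemperateGrowth_xGrad (hte j k)
  have htb (k : Fin d) : (b k).HasTemperateGrowth := (hb k).hasTemperateGrowth
  have htxb (k : Fin d) : (xGrad (b k)).HasTemperateGrowth := hasTemperateGrowth_xGrad (htb k)
  have h1d : (1 : ℝ≥0∞) ≤ d := by exact_mod_cast (by omega : 1 ≤ d)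
  set c : Fin d → Fin d → Euc d → ℂ := fun j k x => ((3 / 2 : ℝ) : ℂ) * e j k x - xGrad (e j k) x
    with hc
  set f : Fin d → Euc d → ℂ := fun k x => ((1 / 2 : ℝ) : ℂ) * b k x - xGrad (b k) x with hf
  have htc (j k : Fin d) : (c j k).HasTemperateGrowth :=
    ((Function.HasTemperateGrowth.const _).mul (hte j k)).sub (htxe j k)
  have htf (k : Fin d) : (f k).HasTemperateGrowth :=
    ((Function.HasTemperateGrowth.const _).mul (htb k)).sub (htxb k)
  have hpdc (j k : Fin d) : pd j (c j k) =
      fun x => ((3 / 2 : ℝ) : ℂ) * pd j (e j k) x - pd j (xGrad (e j k)) x := by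
    ext x
    have h1 : DifferentiableAt ℝ (e j k) x := (hte j k).1.differentiable (by simp) x
    have h2 : DifferentiableAt ℝ (xGrad (e j k)) x := (htxe j k).1.differentiable (by simp) x
    have h3 : DifferentiableAt ℝ (fun x => ((3 / 2 : ℝ) : ℂ) * e j k x) x := h1.const_mul _
    simp only [pd, hc]
    rw [fderiv_fun_sub h3 h2, fderiv_const_mul h1]
    simp
  have hmain := norm_integral_Pop_le hd hS (δ := 5 / 2 * ε) (by positivity) u (hSob u) htc htf
    (fun j k => eLpNorm_const_mul_sub_le le_top (hte j k).1.continuous (htxe j k).1.continuous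
      (by norm_num) le_rfl hε0
      ((eLpNorm_top_le_coefNorm (n := 0) (by omega) (by simp) (e j k)).trans (hnorm_e j k))
      ((eLpNorm_top_le_coefNorm (n := 1) (by omega) le_rfl (e j k)).trans (hnorm_e j k)))
    (fun j k => by
      rw [hpdc]
      exact eLpNorm_const_mul_sub_le h1d (hasTemperateGrowth_pd j (hte j k)).1.continuous
        (hasTemperateGrowth_pd j (htxe j k)).1.continuous (by norm_num) le_rfl hε0
        ((eLpNorm_pd_le_coefNorm (n := 0) (by simp) j (e j k)).trans (hnorm_e j k))
        ((eLpNorm_pd_le_coefNorm (n := 1) le_rfl j (e j k)).trans (hnorm_e j k)))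
    (fun k => eLpNorm_const_mul_sub_le h1d (htb k).1.continuous (htxb k).1.continuous
      (by norm_num) (by norm_num) hε0
      ((eLpNorm_le_coefNorm_one (n := 0) (by simp) (b k)).trans (hnorm_b k))
      ((eLpNorm_le_coefNorm_one (n := 1) le_rfl (b k)).trans (hnorm_b k)))
  have hsplit : ∫ x, (Complex.I * (Pop a b (Aop u) x - Aop (Pop a b u) x)) *
      (starRingEnd ℂ) (u x) = (1 / 2 : ℝ) * (∫ x, Pop a b u x * (starRingEnd ℂ) (u x)) +
        (3 / 2 * gradSq u + ∫ x, Pop c f u x * (starRingEnd ℂ) (u x)) := by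
    have hflat := integrable_Pop
      (c := fun (j k : Fin d) (_ : Euc d) => if j = k then (3 / 2 : ℂ) else 0)
      (e := fun _ _ => 0) (fun _ _ => .const _) (fun _ => .const _) u
    have hcf := integrable_Pop htc htf u
    have hab := integrable_Pop (fun j k => (ha j k).hasTemperateGrowth) htb u
    have hsum := hflat.add hcf
    simp only [Pi.add_def] at hsum
    rw [← integral_Pop_flat, ← integral_add hflat hcf, ← integral_const_mul,
      ← integral_add (hab.const_mul _) hsum]
    refine integral_congr_ae (ae_of_all _ fun x => ?_)
    simp only [commutator_sub_half_eq ha hb u x]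
    ring
  rw [hsplit]
  have hre : -(K * (5 / 2 * ε) * gradSq u) ≤ (∫ x, Pop c f u x * (starRingEnd ℂ) (u x)).re :=
    (neg_le_neg hmain).trans ((neg_le_neg (Complex.abs_re_le_norm _)).trans (neg_abs_le _))
  have hKε : K * (5 / 2 * ε) ≤ 3 / 2 := by
    rw [hε]
    field_simp
    nlinarith
  have hG := mul_le_mul_of_nonneg_right hKε (gradSq_nonneg u)
  rw [Complex.add_re, Complex.add_re, Complex.re_ofReal_mul,
    show (3 / 2 * (gradSq u : ℂ)).re = 3 / 2 * gradSq u by simp [← Complex.ofReal_ofNat]]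
  linarith
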